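/- Let p be an m×m row-stochastic matrix, let e be an m×m nonnegative real matrix, and let j ∈ {1,…,m} be universally accessible for p. Then the linear system x = p·I(-j)·x + (p ∘ e)·1 (where 1 is the column vector of ones and ∘ is the entrywise product) has a unique solution x ∈ ℝ^m, given by x = [I − p·I(-j)]^{-1} (p ∘ e) 1. Componentwise, x is the unique solution of x_i = Σ_{k≠j} p_{ik} x_k + Σ_k p_{ik} e_{ik} for all i. -/

import Mathlib

open Matrix

/-- `Imj j` is the identity matrix with its `j`-th diagonal entry set to `0`;
thus `p * Imj j` equals `p` with its `j`-th column replaced by zeros. -/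
noncomputable def Imj {m : ℕ} (j : Fin m) : Matrix (Fin m) (Fin m) ℝ :=
  Matrix.diagonal (fun i => if i = j then 0 else 1)

/-- Componentwise form of the product of `p * Imj j` with a vector. -/
theorem mul_Imj_mulVec {m : ℕ} (p : Matrix (Fin m) (Fin m) ℝ) (j : Fin m) (x : Fin m → ℝ)
    (i : Fin m) :
    ((p * Imj j) *ᵥ x) i = ∑ k ∈ Finset.univ.erase j, p i k * x k := by
  rw [← Finset.filter_ne' Finset.univ j, Finset.sum_filter, Matrix.mulVec, dotProduct]
  refine Finset.sum_congr rfl fun k _ => ?_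
  rw [Imj, Matrix.mul_diagonal]
  by_cases hk : k = j <;> simp [hk]

/-- If no entry of `x` exceeds `M` in absolute value and `x` is fixed by `p * Imj j`, then from a
state where `|x|` attains `M > 0` one can step neither to `j` nor to a state where `|x| ≠ M`. -/
theorem eq_zero_or_abs_eq_of_mul_Imj_mulVec_eq_self {m : ℕ} {p : Matrix (Fin m) (Fin m) ℝ}
    (hnn : ∀ i k, 0 ≤ p i k) (hrow : ∀ i, ∑ k, p i k = 1) {j : Fin m} {x : Fin m → ℝ}
    (hx : (p * Imj j) *ᵥ x = x) {M : ℝ} (hM : 0 < M) (hle : ∀ k, |x k| ≤ M)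
    {i : Fin m} (hi : |x i| = M) (k : Fin m) :
    p i k = 0 ∨ (k ≠ j ∧ |x k| = M) := by
  set y : Fin m → ℝ := fun k => if k = j then 0 else |x k| with hy
  have hyM : ∀ k, y k ≤ M := fun k => by
    by_cases hk : k = j
    · simp [hy, hk, hM.le]
    · simpa [hy, hk] using hle k
  have hbound : M ≤ ∑ k, p i k * y k := by
    calc M = |∑ k ∈ Finset.univ.erase j, p i k * x k| := by
          rw [← mul_Imj_mulVec, hx, hi]
      _ ≤ ∑ k ∈ Finset.univ.erase j, |p i k * x k| := Finset.abs_sum_le_sum_abs _ _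
      _ = ∑ k, p i k * y k := by
          rw [← Finset.filter_ne' Finset.univ j, Finset.sum_filter]
          refine Finset.sum_congr rfl fun k _ => ?_
          by_cases hk : k = j <;> simp [hy, hk, abs_mul, abs_of_nonneg (hnn i _)]
  have hterm : ∀ k ∈ Finset.univ, 0 ≤ p i k * (M - y k) := fun k _ =>
    mul_nonneg (hnn i k) (sub_nonneg.2 (hyM k))
  have hsum : ∑ k, p i k * (M - y k) = 0 := by
    refine le_antisymm ?_ (Finset.sum_nonneg hterm)
    simp only [mul_sub, Finset.sum_sub_distrib, ← Finset.sum_mul, hrow]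
    linarith
  refine (mul_eq_zero.1 ((Finset.sum_eq_zero_iff_of_nonneg hterm).1 hsum k
    (Finset.mem_univ k))).imp_right fun h => ?_
  by_cases hk : k = j
  · simp [hy, hk, hM.ne'] at h
  · simp only [hy, hk, if_false] at h
    exact ⟨hk, by linarith⟩

/-- If `j` is universally accessible for the stochastic matrix `p`, the only vector fixed by
`p * Imj j` is zero. -/
theorem eq_zero_of_mul_Imj_mulVec_eq_self {m : ℕ} {p : Matrix (Fin m) (Fin m) ℝ}
    (hnn : ∀ i k, 0 ≤ p i k) (hrow : ∀ i, ∑ k, p i k = 1) {j : Fin m}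
    (hUA : ∀ i : Fin m, ∃ n : ℕ, 0 < n ∧ 0 < (p ^ n) i j) {x : Fin m → ℝ}
    (hx : (p * Imj j) *ᵥ x = x) : x = 0 := by
  by_contra hne
  obtain ⟨l, hl⟩ := Function.ne_iff.1 hne
  have : Nonempty (Fin m) := ⟨j⟩
  obtain ⟨i₀, hmax⟩ := Finite.exists_max fun k => |x k|
  have hM : 0 < |x i₀| := (abs_pos.2 hl).trans_le (hmax l)
  have hpow : ∀ n : ℕ, ∀ i, |x i| = |x i₀| → (p ^ (n + 1)) i j = 0 := by
    intro n
    induction n with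
    | zero =>
      intro i hi
      simpa using eq_zero_or_abs_eq_of_mul_Imj_mulVec_eq_self hnn hrow hx hM hmax hi j
    | succ n ih =>
      intro i hi
      rw [pow_succ', Matrix.mul_apply]
      refine Finset.sum_eq_zero fun k _ => ?_
      rcases eq_zero_or_abs_eq_of_mul_Imj_mulVec_eq_self hnn hrow hx hM hmax hi k with h | h
      · rw [h, zero_mul]
      · rw [ih k h.2, mul_zero]
  obtain ⟨n, hn, hpos⟩ := hUA i₀
  obtain ⟨n, rfl⟩ := Nat.exists_eq_succ_of_ne_zero hn.ne'
  exact hpos.ne' (hpow n i₀ rfl)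

/-- If `j` is universally accessible for the stochastic matrix `p`, then `1 - p * Imj j` is
invertible. -/
theorem isUnit_det_one_sub_mul_Imj {m : ℕ} {p : Matrix (Fin m) (Fin m) ℝ}
    (hnn : ∀ i k, 0 ≤ p i k) (hrow : ∀ i, ∑ k, p i k = 1) {j : Fin m}
    (hUA : ∀ i : Fin m, ∃ n : ℕ, 0 < n ∧ 0 < (p ^ n) i j) :
    IsUnit (1 - p * Imj j).det := by
  refine isUnit_iff_ne_zero.2 fun hdet => ?_
  obtain ⟨v, hv, hv0⟩ := Matrix.exists_mulVec_eq_zero_iff.2 hdet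
  rw [Matrix.sub_mulVec, Matrix.one_mulVec, sub_eq_zero] at hv0
  exact hv (eq_zero_of_mul_Imj_mulVec_eq_self hnn hrow hUA hv0.symm)

/-- The solution of an affine fixed point equation `x = A x + b` with `1 - A` invertible. -/
theorem eq_mulVec_add_iff_eq_inv_mulVec {n R : Type*} [Fintype n] [DecidableEq n] [CommRing R]
    {A : Matrix n n R} (hA : IsUnit (1 - A).det) (b x : n → R) :
    x = A *ᵥ x + b ↔ x = (1 - A)⁻¹ *ᵥ b := by
  rw [← sub_eq_iff_eq_add']
  constructor
  · intro h
    rw [← h, show x - A *ᵥ x = (1 - A) *ᵥ x by rw [Matrix.sub_mulVec, Matrix.one_mulVec],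
      Matrix.mulVec_mulVec, Matrix.nonsing_inv_mul _ hA, Matrix.one_mulVec]
  · intro h
    rw [show x - A *ᵥ x = (1 - A) *ᵥ x by rw [Matrix.sub_mulVec, Matrix.one_mulVec], h,
      Matrix.mulVec_mulVec, Matrix.mul_nonsing_inv _ hA, Matrix.one_mulVec]

/-- Let `p` be row-stochastic, `e` nonnegative, and let state `j` be universally
accessible for `p`.  Then the linear system `x = p·I(-j)·x + (p ∘ e)·1` — i.e.,
componentwise, `x i = ∑_{k ≠ j} p i k * x k + ∑ k, p i k * e i k` — has the
unique solution `x = (I - p·I(-j))⁻¹ (p ∘ e) 1`. -/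
theorem stmt_11 {m : ℕ} (p e : Matrix (Fin m) (Fin m) ℝ)
    (hnn : ∀ i k, 0 ≤ p i k) (hrow : ∀ i, ∑ k, p i k = 1)
    (he : ∀ i k, 0 ≤ e i k) (j : Fin m)
    (hUA : ∀ i : Fin m, ∃ n : ℕ, 0 < n ∧ 0 < (p ^ n) i j) :
    (∀ x : Fin m → ℝ,
        x = (p * Imj j) *ᵥ x + (Matrix.hadamard p e) *ᵥ (fun _ => 1) ↔
          x = (1 - p * Imj j)⁻¹ *ᵥ ((Matrix.hadamard p e) *ᵥ (fun _ => 1))) ∧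
      (∀ x : Fin m → ℝ,
        (∀ i, x i = (∑ k ∈ Finset.univ.erase j, p i k * x k) + ∑ k, p i k * e i k) ↔
          x = (1 - p * Imj j)⁻¹ *ᵥ ((Matrix.hadamard p e) *ᵥ (fun _ => 1))) := by
  have key := fun x => eq_mulVec_add_iff_eq_inv_mulVec
    (isUnit_det_one_sub_mul_Imj hnn hrow hUA) (Matrix.hadamard p e *ᵥ fun _ => 1) x
  refine ⟨key, fun x => ?_⟩
  rw [← key x, funext_iff]
  refine forall_congr' fun i => ?_
  rw [Pi.add_apply, mul_Imj_mulVec]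
  simp [Matrix.mulVec, dotProduct]
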